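/- arXiv:2602.10929 — 4 statements merged into one kernel-verified Lean document; each statement's English description precedes it below -/
import Mathlib

section
/- Let L/K be a finite extension of fields, n a natural number, C an L-linear subspace of L^n, and U a K-linear subspace of K^n. Then C(U) = C ∩ (U_L)^⊥, where the orthogonal is taken in L^n with respect to the standard bilinear dot product; in particular C(U) is an L-linear subspace of L^n. -/
open Module

section Defs

variable (K : Type*) {L : Type*} [Field K] [Field L] [Algebra K L] {n : ℕ}

/-- Orthogonal complement with respect to the standard (dot-product) bilinear form. -/
def perp {F : Type*} [Field F] {n : ℕ} (U : Submodule F (Fin n → F)) :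
    Submodule F (Fin n → F) where
  carrier := {x | ∀ u ∈ U, ∑ i, x i * u i = 0}
  add_mem' := by
    intro a b ha hb u hu
    have h : ∑ i, (a + b) i * u i = (∑ i, a i * u i) + ∑ i, b i * u i := by
      simp [add_mul, Finset.sum_add_distrib]
    rw [h, ha u hu, hb u hu, add_zero]
  zero_mem' := by intro u hu; simp
  smul_mem' := by
    intro c a ha u hu
    have h : ∑ i, (c • a) i * u i = c * ∑ i, a i * u i := by
      simp [Finset.mul_sum, mul_assoc]
    rw [h, ha u hu, mul_zero]

/-- The `K`-linear map `f ↦ (f (c i))ᵢ` on `Hom_K(L, K)`. -/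
def rsuppAux (c : Fin n → L) : (L →ₗ[K] K) →ₗ[K] (Fin n → K) where
  toFun f := fun i => f (c i)
  map_add' f g := by funext i; simp
  map_smul' a f := by funext i; simp

@[simp] lemma rsuppAux_apply (c : Fin n → L) (f : L →ₗ[K] K) (i : Fin n) :
    rsuppAux K c f i = f (c i) := rfl

/-- The rank support of a vector `c ∈ Lⁿ`: the `K`-subspace
`{ (f (c 1), …, f (c n)) : f ∈ Hom_K(L, K) }` of `Kⁿ`. -/
def Rsupp (c : Fin n → L) : Submodule K (Fin n → K) :=
  LinearMap.range (rsuppAux K c)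

/-- The rank weight of a vector. -/
noncomputable def wtRvec (c : Fin n → L) : ℕ := finrank K (Rsupp K c)

/-- The rank support of an `L`-subspace `D ⊆ Lⁿ`: the `K`-span of the union of the
rank supports of its elements. -/
def RsuppSub (D : Submodule L (Fin n → L)) : Submodule K (Fin n → K) :=
  Submodule.span K (⋃ d ∈ (D : Set (Fin n → L)), (Rsupp K d : Set (Fin n → K)))

/-- The rank weight of a subspace. -/
noncomputable def wtR (D : Submodule L (Fin n → L)) : ℕ := finrank K (RsuppSub K D)

/-- The subspace `{ c ∈ E : Rsupp(c) ⊆ V }` of elements of `E` whose rank support is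
contained in `V`. -/
def rsuppIn (E : Submodule L (Fin n → L)) (V : Submodule K (Fin n → K)) :
    Submodule L (Fin n → L) where
  carrier := {c | c ∈ E ∧ Rsupp K c ≤ V}
  zero_mem' := by
    refine ⟨E.zero_mem, ?_⟩
    rintro v ⟨f, rfl⟩
    have h : rsuppAux K (0 : Fin n → L) f = 0 := by funext i; simp
    rw [h]; exact V.zero_mem
  add_mem' := by
    rintro a b ⟨haE, haR⟩ ⟨hbE, hbR⟩
    refine ⟨E.add_mem haE hbE, ?_⟩
    rintro v ⟨f, rfl⟩
    have h : rsuppAux K (a + b) f = rsuppAux K a f + rsuppAux K b f := by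
      funext i; simp
    rw [h]
    exact V.add_mem (haR ⟨f, rfl⟩) (hbR ⟨f, rfl⟩)
  smul_mem' := by
    rintro l a ⟨haE, haR⟩
    refine ⟨E.smul_mem l haE, ?_⟩
    rintro v ⟨f, rfl⟩
    have h : rsuppAux K (l • a) f = rsuppAux K a (f ∘ₗ LinearMap.mulLeft K l) := by
      funext i; simp [smul_eq_mul]
    rw [h]
    exact haR ⟨f ∘ₗ LinearMap.mulLeft K l, rfl⟩

/-- Extension of scalars: the `L`-span of (the image in `Lⁿ` of) a `K`-subspace `U ⊆ Kⁿ`. -/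
def extL (K L : Type*) [Field K] [Field L] [Algebra K L] {n : ℕ}
    (U : Submodule K (Fin n → K)) : Submodule L (Fin n → L) :=
  Submodule.span L
    ((fun u : Fin n → K => fun i => algebraMap K L (u i)) '' (U : Set (Fin n → K)))

/-- The minimum rank weight of a nonzero element of `E`. -/
noncomputable def minRW (E : Submodule L (Fin n → L)) : ℕ :=
  sInf {w | ∃ c ∈ E, c ≠ (0 : Fin n → L) ∧ wtRvec K c = w}

/-- The `r`-th generalized rank weight of `C`. -/
noncomputable def genW (C : Submodule L (Fin n → L)) (r : ℕ) : ℕ :=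
  sInf {w | ∃ D : Submodule L (Fin n → L), D ≤ C ∧ finrank L D = r ∧ wtR K D = w}

/-- The generalized rank weight distribution: the number of `r`-dimensional subspaces
of `C` of rank weight `w`. -/
noncomputable def Adist (C : Submodule L (Fin n → L)) (r w : ℕ) : ℕ :=
  Nat.card {D : Submodule L (Fin n → L) // D ≤ C ∧ finrank L D = r ∧ wtR K D = w}

/-- `B^r_t(C)`: the sum over all `t`-dimensional subspaces `U ⊆ Kⁿ` of the number of
`r`-dimensional subspaces of `C(U) = { c ∈ C : Rsupp(c) ⊆ U^⊥ }`. -/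
noncomputable def Bdist (C : Submodule L (Fin n → L)) (r t : ℕ) : ℕ :=
  ∑ᶠ (U : Submodule K (Fin n → K)) (_ : finrank K U = t),
    Nat.card {D : Submodule L (Fin n → L) // D ≤ rsuppIn K C (perp U) ∧ finrank L D = r}

end Defs

/-- The Gaussian binomial coefficient `[a, b]_q`. -/
def gaussBinom (q : ℕ) : ℕ → ℕ → ℕ
  | _, 0 => 1
  | 0, _ + 1 => 0
  | a + 1, b + 1 => gaussBinom q a b + q ^ (b + 1) * gaussBinom q a (b + 1)

/-- The rank support of `c` is orthogonal to `U` exactly when `c` itself is orthogonal to the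
image of `U` in `Lⁿ`. -/
lemma Rsupp_le_perp_iff_sum_eq_zero {K L : Type*} [Field K] [Field L] [Algebra K L] {n : ℕ}
    (c : Fin n → L) (U : Submodule K (Fin n → K)) :
    Rsupp K c ≤ perp U ↔ ∀ u ∈ U, ∑ i, c i * algebraMap K L (u i) = 0 := by
  have apply_sum (f : L →ₗ[K] K) (u : Fin n → K) :
      f (∑ i, c i * algebraMap K L (u i)) = ∑ i, rsuppAux K c f i * u i := by
    rw [map_sum]
    refine Finset.sum_congr rfl fun i _ => ?_
    rw [rsuppAux_apply, ← Algebra.commutes, ← Algebra.smul_def, map_smul, smul_eq_mul, mul_comm]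
  constructor
  · intro h u hu
    refine (Module.forall_dual_apply_eq_zero_iff K _).mp fun f => ?_
    rw [apply_sum]
    exact h ⟨f, rfl⟩ u hu
  · rintro h _ ⟨f, rfl⟩ u hu
    rw [← apply_sum, h u hu, map_zero]

lemma mem_perp_span_iff {F : Type*} [Field F] {n : ℕ} (S : Set (Fin n → F)) (x : Fin n → F) :
    x ∈ perp (Submodule.span F S) ↔ ∀ s ∈ S, ∑ i, x i * s i = 0 := by
  refine ⟨fun h s hs => h s (Submodule.subset_span hs), fun h v hv => ?_⟩
  have hle : Submodule.span F S ≤ LinearMap.ker (dotProductBilin F F x) :=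
    Submodule.span_le.mpr h
  exact hle hv

/-- For an `L`-subspace `C ⊆ Lⁿ` and a `K`-subspace `U ⊆ Kⁿ`,
the set `C(U) = { c ∈ C : Rsupp(c) ⊆ U^⊥ }` equals `C ∩ (U_L)^⊥`; in particular it is an
`L`-subspace of `Lⁿ`. -/
theorem codeU_eq_inf_perp_extL {K L : Type*} [Field K] [Field L] [Algebra K L]
    [FiniteDimensional K L] (n : ℕ) (C : Submodule L (Fin n → L))
    (U : Submodule K (Fin n → K)) :
    {c : Fin n → L | c ∈ C ∧ Rsupp K c ≤ perp U} = ↑(C ⊓ perp (extL K L U)) := by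
  ext c
  change c ∈ C ∧ _ ↔ c ∈ C ∧ c ∈ perp (Submodule.span L _)
  rw [Rsupp_le_perp_iff_sum_eq_zero, mem_perp_span_iff, Set.forall_mem_image]
  rfl
end

section
/- Let L/K be a finite extension of fields, n a natural number, C an L-linear subspace of L^n with C ≠ L^n, and U a K-linear subspace of K^n. If dim_K U < M_1(C^⊥), where C^⊥ is the dual code of C and M_1(C^⊥) is the minimum rank weight of a nonzero element of C^⊥, then dim_L C(U) = dim_L C − dim_K U. -/
open Module

section RankSupport

open Matrix

variable {K L ι : Type*} [Field K] [Field L] [Algebra K L] {n : ℕ}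

/-- `Rsupp(c) ⊆ U^⊥` exactly when `c` is orthogonal over `L` to a spanning family of `U`. -/
lemma rsupp_le_perp_span_iff (G : Matrix ι (Fin n) K) (c : Fin n → L) :
    Rsupp K c ≤ perp (Submodule.span K (Set.range G)) ↔
      G.map (algebraMap K L) *ᵥ c = 0 := by
  have apply_mulVec (f : L →ₗ[K] K) (j : ι) :
      f ((G.map (algebraMap K L) *ᵥ c) j) = ∑ i, f (c i) * G j i := by
    simp only [mulVec, dotProduct, map_apply, ← Algebra.smul_def, map_sum, map_smul, smul_eq_mul]
    simp only [mul_comm]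
  constructor
  · intro h
    ext j
    refine (Module.forall_dual_apply_eq_zero_iff K _).1 fun f => ?_
    rw [apply_mulVec]
    exact h ⟨f, rfl⟩ _ (Submodule.subset_span ⟨j, rfl⟩)
  · rintro h _ ⟨f, rfl⟩ u hu
    induction hu using Submodule.span_induction with
    | mem u hu =>
      obtain ⟨j, rfl⟩ := hu
      simpa [h] using (apply_mulVec f j).symm
    | zero => simp
    | add x y _ _ hx hy =>
      simp only [Pi.add_apply, mul_add, Finset.sum_add_distrib, hx, hy, add_zero]
    | smul a x _ hx =>
      simp only [Pi.smul_apply, smul_eq_mul, mul_left_comm _ a, ← Finset.mul_sum, hx, mul_zero]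

variable [Fintype ι]

lemma rsuppAux_vecMul_map (G : Matrix ι (Fin n) K) (a : ι → L) (f : L →ₗ[K] K) :
    rsuppAux K (a ᵥ* G.map (algebraMap K L)) f = ∑ j, f (a j) • G j := by
  ext i
  simp [vecMul, dotProduct, mul_comm (a _), ← Algebra.smul_def, mul_comm (f _)]

lemma rsupp_vecMul_map_le (G : Matrix ι (Fin n) K) (a : ι → L) :
    Rsupp K (a ᵥ* G.map (algebraMap K L)) ≤ Submodule.span K (Set.range G) := by
  rintro _ ⟨f, rfl⟩
  rw [rsuppAux_vecMul_map]
  exact Submodule.sum_mem _ fun j _ =>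
    Submodule.smul_mem _ _ (Submodule.subset_span ⟨j, rfl⟩)

/-- Rows that are linearly independent over `K` remain so over `L`. -/
lemma eq_zero_of_vecMul_map_eq_zero {G : Matrix ι (Fin n) K} (hG : LinearIndependent K G)
    {a : ι → L} (ha : a ᵥ* G.map (algebraMap K L) = 0) : a = 0 := by
  ext j
  refine (Module.forall_dual_apply_eq_zero_iff K _).1 fun f => ?_
  refine Fintype.linearIndependent_iff.1 hG (fun j => f (a j)) ?_ j
  rw [← rsuppAux_vecMul_map, ha]
  ext i
  simp

/-- A linearly independent family of fewer than `M₁(C^⊥)` vectors of `Kⁿ` imposes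
independent conditions on `C`. -/
lemma range_mulVecLin_domRestrict_eq_top {G : Matrix ι (Fin n) K} (hG : LinearIndependent K G)
    (C : Submodule L (Fin n → L)) (hC : Fintype.card ι < minRW K (perp C)) :
    LinearMap.range ((G.map (algebraMap K L)).mulVecLin.domRestrict C) = ⊤ := by
  classical
  by_contra hne
  obtain ⟨f, hf, hle⟩ := Submodule.exists_le_ker_of_lt_top _ (lt_top_iff_ne_top.2 hne)
  set a : ι → L := fun j => f (Pi.single j 1)
  have hfa (x : ι → L) : f x = a ⬝ᵥ x := by
    conv_lhs => rw [pi_eq_sum_univ' x]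
    simp [a, dotProduct, mul_comm]
  have hperp : a ᵥ* G.map (algebraMap K L) ∈ perp C := fun c hc => by
    change (a ᵥ* G.map (algebraMap K L)) ⬝ᵥ c = 0
    rw [← dotProduct_mulVec, ← hfa]
    exact hle ⟨⟨c, hc⟩, rfl⟩
  have hne_zero : a ᵥ* G.map (algebraMap K L) ≠ 0 := fun h => hf <| by
    refine LinearMap.ext fun x => ?_
    simp [hfa, eq_zero_of_vecMul_map_eq_zero hG h]
  have hmin : minRW K (perp C) ≤ wtRvec K (a ᵥ* G.map (algebraMap K L)) :=
    Nat.sInf_le ⟨_, hperp, hne_zero, rfl⟩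
  have hwt : wtRvec K (a ᵥ* G.map (algebraMap K L)) ≤ Fintype.card ι :=
    (Submodule.finrank_mono (rsupp_vecMul_map_le G a)).trans (finrank_range_le_card G)
  omega

end RankSupport

/-- If `C ⊆ Lⁿ` is an `L`-subspace with `C ≠ Lⁿ` and `U ⊆ Kⁿ` is a `K`-subspace
with `dim_K U < M₁(C^⊥)`, then `dim_L C(U) = dim_L C − dim_K U`. -/
theorem finrank_codeU_of_dim_lt {K L : Type*} [Field K] [Field L] [Algebra K L]
    [FiniteDimensional K L] (n : ℕ) (C : Submodule L (Fin n → L)) (hC : C ≠ ⊤)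
    (U : Submodule K (Fin n → K)) (hU : finrank K U < minRW K (perp C)) :
    finrank L (rsuppIn K C (perp U)) = finrank L C - finrank K U := by
  let b := finBasis K U
  let G : Matrix (Fin (finrank K U)) (Fin n) K := fun j => b j
  have hG : LinearIndependent K G := b.linearIndependent.map' U.subtype U.ker_subtype
  have hspan : Submodule.span K (Set.range G) = U := by
    change Submodule.span K (Set.range (U.subtype ∘ b)) = U
    rw [Set.range_comp, Submodule.span_image, b.span_eq, Submodule.map_top, U.range_subtype]
  let φ := (G.map (algebraMap K L)).mulVecLin.domRestrict C
  have hker : (LinearMap.ker φ).map C.subtype = rsuppIn K C (perp U) := by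
    ext c
    change _ ↔ c ∈ C ∧ Rsupp K c ≤ perp U
    have hmem := rsupp_le_perp_span_iff G c
    rw [hspan] at hmem
    simp [φ, hmem, and_comm]
  have hrange : finrank L (LinearMap.range φ) = finrank K U := by
    rw [range_mulVecLin_domRestrict_eq_top hG C (by simpa using hU)]
    simp
  have hdim := φ.finrank_range_add_finrank_ker
  rw [← hker, Submodule.finrank_map_subtype_eq]
  omega
end

section
/- Let L/K be a finite extension of fields, n a natural number, C an L-linear subspace of L^n, and U a K-linear subspace of K^n. Then dim_L C(U) + dim_K U = dim_L C + dim_L C^⊥(U^⊥), where C^⊥ is the dual code of C and C^⊥(U^⊥) = { c ∈ C^⊥ : Rsupp(c) ⊆ U }. -/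
open Module

/-- A bilinear map between finite-dimensional spaces and its flip have the same rank. -/
theorem finrank_range_flip_eq {F V W : Type*} [Field F] [AddCommGroup V] [Module F V]
    [AddCommGroup W] [Module F W] [FiniteDimensional F W] (B : V →ₗ[F] W →ₗ[F] F) :
    finrank F (LinearMap.range B.flip) = finrank F (LinearMap.range B) := by
  have h : B.flip = LinearMap.dualMap B ∘ₗ (evalEquiv F W).toLinearMap := by
    ext w v
    simp
  rw [h, LinearMap.range_comp_of_range_eq_top _ (LinearEquiv.range _)]
  exact LinearMap.finrank_range_dualMap_eq_finrank_range B

theorem mem_perp {F : Type*} [Field F] {n : ℕ} {U : Submodule F (Fin n → F)} {x : Fin n → F} :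
    x ∈ perp U ↔ ∀ u ∈ U, ∑ i, x i * u i = 0 :=
  Iff.rfl

theorem finrank_inf_perp_add {F : Type*} [Field F] {n : ℕ} (C E : Submodule F (Fin n → F)) :
    finrank F ↥(C ⊓ perp E) + finrank F E = finrank F C + finrank F ↥(perp C ⊓ E) := by
  let B : C →ₗ[F] E →ₗ[F] F := (dotProductBilin F F).domRestrict₁₂ C E
  have hB : (LinearMap.ker B).map C.subtype = C ⊓ perp E := by
    ext x
    simp only [Submodule.mem_map, LinearMap.mem_ker, LinearMap.ext_iff, Submodule.subtype_apply,
      Subtype.exists, Subtype.forall, exists_and_right, exists_eq_right]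
    exact ⟨fun ⟨hx, h⟩ => ⟨hx, fun u hu => h u hu⟩, fun ⟨hx, h⟩ => ⟨hx, fun u hu => h u hu⟩⟩
  have hB' : (LinearMap.ker B.flip).map E.subtype = perp C ⊓ E := by
    ext x
    rw [inf_comm]
    simp only [Submodule.mem_map, LinearMap.mem_ker, LinearMap.ext_iff, Submodule.subtype_apply,
      Subtype.exists, Subtype.forall, exists_and_right, exists_eq_right]
    exact exists_prop.trans <| and_congr_right fun _ => forall₂_congr fun a _ =>
      Eq.congr_left (dotProduct_comm a x)
  have h₁ : finrank F ↥(C ⊓ perp E) = finrank F (LinearMap.ker B) := by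
    rw [← hB]
    exact Submodule.finrank_map_subtype_eq _ _
  have h₂ : finrank F ↥(perp C ⊓ E) = finrank F (LinearMap.ker B.flip) := by
    rw [← hB']
    exact Submodule.finrank_map_subtype_eq _ _
  have h₃ := B.finrank_range_add_finrank_ker
  have h₄ := B.flip.finrank_range_add_finrank_ker
  have h₅ := finrank_range_flip_eq B
  omega

section ExtensionOfScalars

variable {K L : Type*} [Field K] [Field L] [Algebra K L] {n : ℕ}

theorem finrank_extL (U : Submodule K (Fin n → K)) : finrank L (extL K L U) = finrank K U := by
  let b := finBasis K U
  have hb : LinearIndependent K fun i => (b i : Fin n → K) :=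
    b.linearIndependent.map' U.subtype U.ker_subtype
  have hspan : extL K L U =
      Submodule.span L (Set.range fun i => algebraMap K L ∘ (b i : Fin n → K)) := by
    refine le_antisymm (Submodule.span_le.2 ?_) (Submodule.span_le.2 ?_)
    · rintro _ ⟨u, hu, rfl⟩
      have hsum : (fun i => algebraMap K L (u i)) =
          ∑ j, algebraMap K L (b.repr ⟨u, hu⟩ j) • (algebraMap K L ∘ (b j : Fin n → K)) := by
        funext i
        have h := congrArg (fun v : U => (v : Fin n → K) i) (b.sum_repr ⟨u, hu⟩)
        simp only [Submodule.coe_sum, Submodule.coe_smul, Finset.sum_apply, Pi.smul_apply,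
          smul_eq_mul] at h
        simp [← h, -algebraMap_smul, Algebra.smul_def]
      simp only [SetLike.mem_coe, hsum]
      exact Submodule.sum_mem _ fun j _ =>
        Submodule.smul_mem _ _ (Submodule.subset_span ⟨j, rfl⟩)
    · rintro _ ⟨j, rfl⟩
      exact Submodule.subset_span ⟨b j, (b j).2, rfl⟩
  rw [hspan, finrank_span_eq_card (linearIndependent_algebraMap_comp_iff.2 hb),
    Fintype.card_fin]

theorem mem_perp_extL {U : Submodule K (Fin n → K)} {c : Fin n → L} :
    c ∈ perp (extL K L U) ↔ ∀ u ∈ U, ∑ i, c i * algebraMap K L (u i) = 0 := by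
  refine ⟨fun h u hu => h _ (Submodule.subset_span ⟨u, hu, rfl⟩), fun h v hv => ?_⟩
  induction hv using Submodule.span_induction with
  | mem v hv =>
    obtain ⟨u, hu, rfl⟩ := hv
    exact h u hu
  | zero => simp
  | add v w _ _ hv hw => simp [mul_add, Finset.sum_add_distrib, hv, hw]
  | smul a v _ hv => simp [mul_left_comm _ a, ← Finset.mul_sum, hv]

theorem Rsupp_le_perp_iff {U : Submodule K (Fin n → K)} {c : Fin n → L} :
    Rsupp K c ≤ perp U ↔ c ∈ perp (extL K L U) := by
  have key (f : L →ₗ[K] K) (u : Fin n → K) :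
      ∑ i, f (c i) * u i = f (∑ i, c i * algebraMap K L (u i)) := by
    simp [map_sum, mul_comm (c _), ← Algebra.smul_def, mul_comm (f _)]
  rw [mem_perp_extL]
  constructor
  · intro h u hu
    refine (forall_dual_apply_eq_zero_iff K _).1 fun f => ?_
    rw [← key]
    exact h ⟨f, rfl⟩ u hu
  · rintro h _ ⟨f, rfl⟩ u hu
    simp only [rsuppAux_apply]
    rw [key, h u hu, map_zero]

theorem rsuppIn_perp (C : Submodule L (Fin n → L)) (U : Submodule K (Fin n → K)) :
    rsuppIn K C (perp U) = C ⊓ perp (extL K L U) := by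
  ext c
  exact and_congr_right fun _ => Rsupp_le_perp_iff

theorem rsuppIn_eq_inf_extL [FiniteDimensional K L] (D : Submodule L (Fin n → L))
    (U : Submodule K (Fin n → K)) : rsuppIn K D U = D ⊓ extL K L U := by
  have hle : extL K L U ≤ rsuppIn K ⊤ U := by
    refine Submodule.span_le.2 ?_
    rintro _ ⟨u, hu, rfl⟩
    refine ⟨Submodule.mem_top, ?_⟩
    rintro _ ⟨f, rfl⟩
    have h : rsuppAux K (fun i => algebraMap K L (u i)) f = f 1 • u := by
      funext i
      simp [Algebra.algebraMap_eq_smul_one, mul_comm]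
    rw [h]
    exact U.smul_mem _ hu
  ext c
  refine and_congr_right fun _ => ⟨fun h => ?_, fun h => (hle h).2⟩
  let b := finBasis K L
  have hc : c = ∑ j, b j • fun i => algebraMap K L (rsuppAux K c (b.coord j) i) := by
    funext i
    conv_lhs => rw [← b.sum_repr (c i)]
    simp [Algebra.smul_def, mul_comm]
  rw [hc]
  exact Submodule.sum_mem _ fun j _ =>
    Submodule.smul_mem _ _ (Submodule.subset_span ⟨_, h ⟨b.coord j, rfl⟩, rfl⟩)

end ExtensionOfScalars

/-- For an `L`-subspace `C ⊆ Lⁿ` and a `K`-subspace `U ⊆ Kⁿ`,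
`dim_L C(U) + dim_K U = dim_L C + dim_L C^⊥(U^⊥)`, where
`C^⊥(U^⊥) = { c ∈ C^⊥ : Rsupp(c) ⊆ U }`. -/
theorem finrank_codeU_add_dim {K L : Type*} [Field K] [Field L] [Algebra K L]
    [FiniteDimensional K L] (n : ℕ) (C : Submodule L (Fin n → L))
    (U : Submodule K (Fin n → K)) :
    finrank L (rsuppIn K C (perp U)) + finrank K U
      = finrank L C + finrank L (rsuppIn K (perp C) U) := by
  rw [rsuppIn_perp, rsuppIn_eq_inf_extL, ← finrank_extL (L := L) U]
  exact finrank_inf_perp_add C (extL K L U)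
end

section
/- Let L/K be a finite extension of fields, n a natural number, and D an L-linear subspace of L^n. Then dim_L D ≤ wt_R(D), i.e., the L-dimension of D is at most the K-dimension of its rank support. -/
open Module

lemma mem_extL_of_Rsupp_le {K L : Type*} [Field K] [Field L] [Algebra K L]
    [FiniteDimensional K L] {n : ℕ} {U : Submodule K (Fin n → K)} {c : Fin n → L}
    (h : Rsupp K c ≤ U) : c ∈ extL K L U := by
  let b := finBasis K L
  have hc : c = ∑ j, b j • fun i => algebraMap K L (rsuppAux K c (b.coord j) i) := by
    funext i
    simpa [Algebra.smul_def, mul_comm] using (b.sum_repr (c i)).symm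
  rw [hc]
  exact Submodule.sum_mem _ fun j _ => Submodule.smul_mem _ _ <|
    Submodule.subset_span ⟨_, h ⟨b.coord j, rfl⟩, rfl⟩

lemma le_extL_RsuppSub {K L : Type*} [Field K] [Field L] [Algebra K L]
    [FiniteDimensional K L] {n : ℕ} (D : Submodule L (Fin n → L)) :
    D ≤ extL K L (RsuppSub K D) := fun _ hd =>
  mem_extL_of_Rsupp_le fun _ hx => Submodule.subset_span (Set.mem_biUnion hd hx)

lemma finrank_extL_le {K L : Type*} [Field K] [Field L] [Algebra K L] {n : ℕ}
    (U : Submodule K (Fin n → K)) : finrank L (extL K L U) ≤ finrank K U := by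
  let b := finBasis K U
  let w : Fin (finrank K U) → Fin n → L := fun j i => algebraMap K L ((b j : Fin n → K) i)
  have hle : extL K L U ≤ Submodule.span L (Set.range w) := by
    refine Submodule.span_le.2 ?_
    rintro _ ⟨u, hu, rfl⟩
    have hu' : (fun i => algebraMap K L (u i)) =
        ∑ j, algebraMap K L (b.repr ⟨u, hu⟩ j) • w j := by
      have h : ∑ j, b.repr ⟨u, hu⟩ j • (b j : Fin n → K) = u := by
        simpa only [map_sum, map_smul, Submodule.subtype_apply] using
          congrArg U.subtype (b.sum_repr ⟨u, hu⟩)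
      funext i
      rw [← congrFun h i]
      simp [w, Algebra.smul_def]
    change (fun i => algebraMap K L (u i)) ∈ Submodule.span L (Set.range w)
    rw [hu']
    exact Submodule.sum_mem _ fun j _ =>
      Submodule.smul_mem _ _ (Submodule.subset_span ⟨j, rfl⟩)
  calc finrank L (extL K L U) ≤ finrank L (Submodule.span L (Set.range w)) :=
        Submodule.finrank_mono hle
    _ ≤ Fintype.card (Fin (finrank K U)) := finrank_range_le_card w
    _ = finrank K U := Fintype.card_fin _

/-- For a finite extension `L/K` and an `L`-subspace `D ⊆ Lⁿ`,
`dim_L D ≤ wt_R(D) = dim_K Rsupp(D)`. -/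
theorem finrank_le_wtR {K L : Type*} [Field K] [Field L] [Algebra K L]
    [FiniteDimensional K L] (n : ℕ) (D : Submodule L (Fin n → L)) :
    finrank L D ≤ wtR K D := by
  exact (Submodule.finrank_mono (le_extL_RsuppSub (K := K) D)).trans (finrank_extL_le _)
end
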